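/- Let α be a type with decidable equality, let F = FreeGroup α, and let ‖·‖ denote the word-length norm on F (the length of the reduced word representing an element). For every g ∈ F with g ≠ 1, the set {‖x * g * x⁻¹‖ : x ∈ F} attains a minimum value L ≥ 1 (the cyclically reduced length of g), one has ‖g^n‖ = n·L + (‖g‖ − L) for every n ≥ 1, and consequently lim_{n→∞} ‖g^n‖ / n = L. -/

import Mathlib

namespace FreeGroup

variable {α : Type*} [DecidableEq α]

open reduceCyclically

theorem norm_pow_eq (g : FreeGroup α) {n : ℕ} (hn : n ≠ 0) :
    norm (g ^ n) =
      n * (reduceCyclically g.toWord).length + 2 * (conjugator g.toWord).length := by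
  simp only [norm, toWord_pow, reduce_flatten_replicate isReduced_toWord, hn, if_false,
    List.length_append, List.length_flatten, List.map_replicate, List.sum_replicate,
    invRev_length, smul_eq_mul]
  ring

theorem norm_eq_length_reduceCyclically_add (g : FreeGroup α) :
    norm g = (reduceCyclically g.toWord).length + 2 * (conjugator g.toWord).length := by
  simpa using norm_pow_eq g one_ne_zero

theorem norm_pow_le (g : FreeGroup α) (n : ℕ) : norm (g ^ n) ≤ n * norm g := by
  induction n with
  | zero => simp
  | succ n ih =>
    rw [pow_succ, add_mul, one_mul]
    exact (norm_mul_le _ _).trans (Nat.add_le_add_right ih _)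

theorem mk_reduceCyclically_toWord (g : FreeGroup α) :
    mk (reduceCyclically g.toWord) =
      (mk (conjugator g.toWord))⁻¹ * g * ((mk (conjugator g.toWord))⁻¹)⁻¹ := by
  have h : mk (conjugator g.toWord) * mk (reduceCyclically g.toWord) *
      (mk (conjugator g.toWord))⁻¹ = g := by
    rw [inv_mk, mul_mk, mul_mk, conj_conjugator_reduceCyclically, mk_toWord]
  nth_rw 3 [← h]
  group

theorem norm_mk_reduceCyclically_toWord (g : FreeGroup α) :
    norm (mk (reduceCyclically g.toWord)) = (reduceCyclically g.toWord).length := by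
  rw [norm, toWord_mk, (isCyclicallyReduced isReduced_toWord).isReduced.reduce_eq]

theorem length_reduceCyclically_toWord_pos {g : FreeGroup α} (hg : g ≠ 1) :
    0 < (reduceCyclically g.toWord).length := by
  rw [← norm_mk_reduceCyclically_toWord, Nat.pos_iff_ne_zero, Ne, norm_eq_zero,
    mk_reduceCyclically_toWord, conj_eq_one_iff]
  exact hg

theorem length_reduceCyclically_toWord_le_norm_conj (g x : FreeGroup α) :
    (reduceCyclically g.toWord).length ≤ norm (x * g * x⁻¹) := by
  by_contra! hlt
  set n := 2 * norm x + 1 with hn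
  have hpow : g ^ n = x⁻¹ * (x * g * x⁻¹) ^ n * x := by
    rw [conj_pow]
    group
  have h₁ : norm (g ^ n) ≤ norm x + n * norm (x * g * x⁻¹) + norm x := by
    rw [hpow]
    refine (norm_mul_le _ _).trans (Nat.add_le_add_right ((norm_mul_le _ _).trans ?_) _)
    rw [norm_inv_eq]
    exact Nat.add_le_add_left (norm_pow_le _ _) _
  rw [norm_pow_eq g (by omega)] at h₁
  have h₂ := Nat.mul_le_mul_left n (Nat.succ_le_of_lt hlt)
  rw [Nat.mul_succ] at h₂
  omega

end FreeGroup

/-- for a nontrivial element `g` of a free group, the word-length norms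
of the conjugates `x * g * x⁻¹` attain a minimum `L ≥ 1` (the cyclically reduced
length of `g`), `‖gⁿ‖ = n·L + (‖g‖ − L)` for all `n ≥ 1`, and `‖gⁿ‖/n → L`. -/
theorem stmt18 {α : Type*} [DecidableEq α] (g : FreeGroup α) (hg : g ≠ 1) :
    ∃ L : ℕ, 1 ≤ L ∧
      IsLeast {n : ℕ | ∃ x : FreeGroup α, n = FreeGroup.norm (x * g * x⁻¹)} L ∧
      (∀ n : ℕ, 1 ≤ n → FreeGroup.norm (g ^ n) = n * L + (FreeGroup.norm g - L)) ∧
      Filter.Tendsto (fun n : ℕ => (FreeGroup.norm (g ^ n) : ℝ) / n)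
        Filter.atTop (nhds (L : ℝ)) := by
  refine ⟨(FreeGroup.reduceCyclically g.toWord).length,
    FreeGroup.length_reduceCyclically_toWord_pos hg,
    ⟨⟨(FreeGroup.mk (FreeGroup.reduceCyclically.conjugator g.toWord))⁻¹, ?_⟩, ?_⟩,
    fun n hn ↦ ?_, ?_⟩
  · rw [← FreeGroup.mk_reduceCyclically_toWord, FreeGroup.norm_mk_reduceCyclically_toWord]
  · rintro _ ⟨x, rfl⟩
    exact FreeGroup.length_reduceCyclically_toWord_le_norm_conj g x
  · rw [FreeGroup.norm_pow_eq g (by omega), FreeGroup.norm_eq_length_reduceCyclically_add g,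
      Nat.add_sub_cancel_left]
  · set L := (FreeGroup.reduceCyclically g.toWord).length
    set c := (FreeGroup.reduceCyclically.conjugator g.toWord).length
    have hlim : Filter.Tendsto (fun n : ℕ ↦ (L : ℝ) + (2 * c : ℝ) / n) Filter.atTop
        (nhds (L : ℝ)) := by
      simpa using (tendsto_const_div_atTop_nhds_zero_nat (2 * c : ℝ)).const_add (L : ℝ)
    refine hlim.congr' ?_
    filter_upwards [Filter.eventually_ne_atTop 0] with n hn
    rw [FreeGroup.norm_pow_eq g hn]
    push_cast
    field_simp
    ring
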